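/- arXiv:2008.07503 — 3 statements merged into one kernel-verified Lean document; each statement's English description precedes it below -/
import Mathlib

section
/- The Ramanujan identity for E₂: the derivative q d/dq E₂(τ) = (E₂(τ)² - E₄(τ))/12, where E₂(τ) = 1 - 24 ∑_{n≥1} σ₁(n) q^n and E₄(τ) = 1 + 240 ∑_{n≥1} σ₃(n) q^n with q = e^{2πiτ}. -/
open Complex Real

/-- The weight-2 Eisenstein series as a function of `τ`:
`E₂(τ) = 1 - 24 ∑_{n ≥ 1} σ₁(n) qⁿ`, `q = e^{2πiτ}`. -/
noncomputable def E₂τ (τ : ℂ) : ℂ :=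
  1 - 24 * ∑' n : ℕ,
    (ArithmeticFunction.sigma 1 (n + 1) : ℂ) * Complex.exp (2 * π * Complex.I * τ) ^ (n + 1)

/-- The weight-4 Eisenstein series as a function of `τ`:
`E₄(τ) = 1 + 240 ∑_{n ≥ 1} σ₃(n) qⁿ`, `q = e^{2πiτ}`. -/
noncomputable def E₄τ (τ : ℂ) : ℂ :=
  1 + 240 * ∑' n : ℕ,
    (ArithmeticFunction.sigma 3 (n + 1) : ℂ) * Complex.exp (2 * π * Complex.I * τ) ^ (n + 1)


section RamanujanAux

open UpperHalfPlane hiding I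
open ModularForm EisensteinSeries Filter Topology Manifold MatrixGroups Derivative

lemma tendsto_of_hasSum_q {f : ℍ → ℂ} {c : ℕ → ℂ}
    (hf : ∀ τ : ℍ, HasSum (fun m ↦ c m • Function.Periodic.qParam 1 τ ^ m) (f τ)) :
    Tendsto f atImInfty (𝓝 (c 0)) := by
  have hg : ∀ τ : ℍ, HasSum (fun m ↦ c (m + 1) • Function.Periodic.qParam 1 τ ^ m)
      ((f τ - c 0) / Function.Periodic.qParam 1 τ) := by
    intro τ
    have h0 : Function.Periodic.qParam 1 (τ : ℂ) ≠ 0 := Function.Periodic.qParam_ne_zero _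
    have h1 := (hasSum_nat_add_iff' 1).mpr (hf τ)
    simp only [Finset.sum_range_one, pow_zero, smul_eq_mul, mul_one] at h1
    have h2 := h1.div_const (Function.Periodic.qParam 1 (τ : ℂ))
    convert! h2 using 1
    ext m
    rw [smul_eq_mul, pow_succ]
    field_simp
  have hb := isBoundedAtImInfty_of_hasSum_qExpansion one_pos hg
  have hq := qParam_tendsto_atImInfty one_pos
  have h := (hq.zero_mul_isBoundedUnder_le hb.isBoundedUnder_le).add_const (c 0)
  rw [zero_add] at h
  refine h.congr fun τ ↦ ?_
  have h0 : Function.Periodic.qParam 1 (τ : ℂ) ≠ 0 := Function.Periodic.qParam_ne_zero _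
  field_simp
  ring

lemma tendsto_D_E2 : IsZeroAtImInfty (D E2) := by
  have hb := isBoundedAtImInfty_E2
  rw [isBoundedAtImInfty_iff] at hb
  obtain ⟨M, A, hMA⟩ := hb
  rw [isZeroAtImInfty_iff]
  intro ε hε
  have hd := UpperHalfPlane.mdifferentiable_iff.mp E2_mdifferentiable
  have hMp : 0 ≤ M := (norm_nonneg _).trans (hMA ⟨(|A| + 1) * Complex.I, by simp; positivity⟩
    (by simp [UpperHalfPlane.im]; linarith [le_abs_self A]))
  refine ⟨|A| + 1 + (M + 1) / ε, fun z hz ↦ ?_⟩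
  set R : ℝ := (M + 1) / ε with hR
  have hRp : 0 < R := by positivity
  have hpos : ∀ w ∈ Metric.closedBall (z : ℂ) R, |A| + 1 ≤ w.im := by
    intro w hw
    have h1 : |(w - z).im| ≤ R := (Complex.abs_im_le_norm _).trans (by simpa [dist_eq_norm] using hw)
    have h2 := (abs_le.mp h1).1
    have h3 : (z : ℂ).im = z.im := rfl
    simp only [Complex.sub_im] at h2
    linarith
  have hpos' : ∀ w ∈ Metric.closedBall (z : ℂ) R, 0 < w.im := fun w hw ↦ by
    have := hpos w hw; have := abs_nonneg A; linarith
  have key : ‖deriv (E2 ∘ ofComplex) z‖ ≤ M / R := by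
    apply Complex.norm_deriv_le_of_forall_mem_sphere_norm_le hRp
    · apply DifferentiableOn.diffContOnCl
      rw [closure_ball _ hRp.ne']
      exact hd.mono fun w hw ↦ hpos' w hw
    · intro w hw
      have hw' := Metric.sphere_subset_closedBall hw
      have h0 := hpos' w hw'
      rw [Function.comp_apply, ofComplex_apply_of_im_pos h0]
      apply hMA
      change A ≤ w.im
      linarith [hpos w hw', le_abs_self A]
  rw [normalizedDerivOfComplex, norm_mul]
  have h2 : ‖(2 * π * I : ℂ)⁻¹‖ ≤ 1 := by
    rw [norm_inv]
    apply inv_le_one_of_one_le₀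
    simp [abs_of_pos Real.pi_pos]
    linarith [Real.pi_gt_three]
  calc _ ≤ 1 * (M / R) := by gcongr
    _ ≤ ε := by
      rw [one_mul, div_le_iff₀ hRp, hR]; field_simp; linarith

lemma hasDerivAt_D2 (γ : SL(2, ℤ)) (z : ℍ) :
    D (D2 γ) z = - (γ 1 0 : ℂ) ^ 2 / denom γ z ^ 2 := by
  have hz : denom γ z ≠ 0 := denom_ne_zero _ z
  have h := (hasDerivAt_denom_zpow (γ : GL (Fin 2) ℝ) (-1) z).const_mul (2 * π * I * γ 1 0)
  have he : (D2 γ ∘ ofComplex) =ᶠ[𝓝 (z : ℂ)]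
      fun w ↦ (2 * π * I * γ 1 0) * (denom γ w) ^ (-1 : ℤ) := by
    filter_upwards [isOpen_upperHalfPlaneSet.mem_nhds z.im_pos] with w hw
    simp [D2, ofComplex_apply_of_im_pos hw, div_eq_mul_inv]
  rw [normalizedDerivOfComplex, (h.congr_of_eventuallyEq he).deriv]
  have := Complex.two_pi_I_ne_zero
  have hpi : (π : ℂ) ≠ 0 := by exact_mod_cast Real.pi_ne_zero
  simp [zpow_neg]
  field_simp
  linear_combination (γ 1 0 : ℂ) ^ 2 * I_sq

noncomputable def ramF : ℍ → ℂ := D E2 - (12⁻¹ : ℂ) • (E2 * E2) + (12⁻¹ : ℂ) • (E₄ : ℍ → ℂ)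

lemma ramF_mdiff : MDiff ramF := by
  have h1 := normalizedDerivOfComplex_mdifferentiable E2_mdifferentiable
  have h2 := E2_mdifferentiable.mul E2_mdifferentiable
  exact (h1.sub (h2.const_smul _)).add (E₄.holo'.const_smul _)

lemma ramF_slash (γ : SL(2, ℤ)) : ramF ∣[(4 : ℤ)] γ = ramF := by
  have hE := E2_slash_action γ
  have h1 := normalizedDerivOfComplex_SL_slash (k := 2) E2_mdifferentiable (γ := γ)
  have hD2 : MDiff (D2 γ) := by
    have : D2 γ = (2 * riemannZeta 2) • (E2 - E2 ∣[(2:ℤ)] γ) := by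
      rw [hE]; ext z; simp [riemannZeta_two]; field_simp
    rw [this]
    have hs : MDiff (E2 ∣[(2:ℤ)] γ) := E2_mdifferentiable.slash _ _
    exact (E2_mdifferentiable.sub hs).const_smul _
  have h4 : (E₄ : ℍ → ℂ) ∣[(4 : ℤ)] γ = E₄ := E₄.slash_action_eq' _ ⟨γ, rfl⟩
  have h22 := ModularForm.mul_slash_SL2 2 2 γ E2 E2
  rw [hE] at h1 h22
  rw [normalizedDerivOfComplex_sub _ _ E2_mdifferentiable (hD2.const_smul _),
    normalizedDerivOfComplex_smul _ _ hD2] at h1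
  ext z
  have h1z := congrFun h1 z
  have h22z := congrFun h22 z
  simp only [Pi.sub_apply, Pi.smul_apply, hasDerivAt_D2, Pi.mul_apply, D2, smul_eq_mul, riemannZeta_two] at h1z h22z
  norm_num at h1z h22z
  rw [ramF, SlashAction.add_slash, sub_eq_add_neg, SlashAction.add_slash, SlashAction.neg_slash, SL_smul_slash, SL_smul_slash, h4]
  simp only [Pi.add_apply, Pi.smul_apply, Pi.neg_apply, Pi.mul_apply, smul_eq_mul]
  rw [h22z]
  have hz : denom γ z ≠ 0 := denom_ne_zero _ z
  have hpi : (π : ℂ) ≠ 0 := by exact_mod_cast Real.pi_ne_zero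
  rw [← sub_eq_iff_eq_add] at h1z
  rw [← h1z]
  generalize denom (γ : GL (Fin 2) ℝ) z = d at *
  field_simp
  ring_nf
  simp only [I_sq]
  ring

lemma ramF_zero_infty : IsZeroAtImInfty ramF := by
  have hE2 : Tendsto E2 atImInfty (𝓝 1) := by
    simpa using tendsto_of_hasSum_q (f := E2) (c := fun m ↦ if m = 0 then 1 else -24 * (ArithmeticFunction.sigma 1 m : ℂ)) fun τ ↦ by
      simpa only [Function.Periodic.qParam, ofReal_one, div_one] using hasSum_qExpansion_E2 (z := τ)
  have hE4 : Tendsto (E₄ : ℍ → ℂ) atImInfty (𝓝 1) := by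
    have := tendsto_of_hasSum_q (f := E₄) (c := fun m ↦ (qExpansion 1 E₄).coeff m) fun τ ↦
      ModularForm.hasSum_qExpansion E₄ one_pos one_mem_strictPeriods_SL τ
    rwa [E_qExpansion_coeff_zero _ ⟨2, rfl⟩] at this
  have h := (tendsto_D_E2.sub ((hE2.mul hE2).const_smul (12⁻¹ : ℂ))).add (hE4.const_smul (12⁻¹ : ℂ))
  simpa [IsZeroAtImInfty, ZeroAtFilter, ramF] using! h

noncomputable def ramC : CuspForm 𝒮ℒ 4 where
  toFun := ramF
  slash_action_eq' A hA := by
    obtain ⟨A, rfl⟩ := hA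
    exact ramF_slash A
  holo' := ramF_mdiff
  zero_at_cusps' hc := by
    rw [Subgroup.IsArithmetic.isCusp_iff_isCusp_SL2Z] at hc
    rw [OnePoint.isZeroAt_iff_forall_SL2Z hc]
    intro γ _
    rw [ramF_slash]
    exact ramF_zero_infty

lemma ramF_eq_zero (z : ℍ) : ramF z = 0 := by
  have h : ramC = 0 :=
    rank_zero_iff_forall_zero.mp (CuspForm.rank_eq_zero_of_weight_lt_twelve (by norm_num)) ramC
  exact congrArg (fun f : CuspForm 𝒮ℒ 4 ↦ f z) h

lemma E2τ_eq (z : ℍ) : E₂τ z = E2 z := by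
  rw [E2_eq_tsum_cexp, E₂τ, tsum_pnat_eq_tsum_succ (f := fun n ↦ (ArithmeticFunction.sigma 1 n : ℂ) * cexp (2 * π * I * z) ^ n)]

lemma E4τ_eq (z : ℍ) : E₄τ z = E₄ z := by
  rw [EisensteinSeries.q_expansion_bernoulli _ ⟨2, rfl⟩, E₄τ]
  simp only [zpow_natCast]
  rw [tsum_pnat_eq_tsum_succ (f := fun n ↦ (ArithmeticFunction.sigma (4 - 1) n : ℂ) * cexp (2 * π * I * z) ^ n), show bernoulli 4 = -1 / 30 by decide +kernel]
  norm_num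

end RamanujanAux

/-- **Ramanujan identity for `E₂`.**
`q d/dq E₂ = (1/2πi) ∂_τ E₂ = (E₂² - E₄)/12` on the upper half-plane. -/
theorem ramanujan_E2 (τ : ℂ) (hτ : 0 < τ.im) :
    (2 * π * Complex.I)⁻¹ * deriv E₂τ τ = (E₂τ τ ^ 2 - E₄τ τ) / 12 := by
  have h := ramF_eq_zero ⟨τ, hτ⟩
  have h2 := E2τ_eq ⟨τ, hτ⟩
  have h4 := E4τ_eq ⟨τ, hτ⟩
  have hd : deriv E₂τ τ = deriv (EisensteinSeries.E2 ∘ UpperHalfPlane.ofComplex) τ := by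
    apply Filter.EventuallyEq.deriv_eq
    filter_upwards [UpperHalfPlane.isOpen_upperHalfPlaneSet.mem_nhds hτ] with w hw
    rw [Function.comp_apply, UpperHalfPlane.ofComplex_apply_of_im_pos hw, ← E2τ_eq]
  simp only [ramF, Pi.add_apply, Pi.sub_apply, Pi.smul_apply, Pi.mul_apply, smul_eq_mul,
    Derivative.normalizedDerivOfComplex, ← h2, ← h4, ← hd] at h
  linear_combination h
end

section
/- Under the hypotheses of the Weierstrass equation 2℘'' = 12℘² - (4/3)π⁴E₄, the further relation (℘')² = 4℘³ - (4/3)π⁴E₄℘ - (8/27)π⁶E₆, and ∫_A ℘ dz = -(π²/3)E₂, the A-cycle integral of the cube satisfies ∫_A ℘(z;τ)³ dz = -(π⁶/15) E₂(τ)E₄(τ) + (4π⁶/135) E₆(τ). -/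
open Complex Real

/-- The Weierstrass `℘`-function for the lattice `Λ_τ = ℤ + ℤτ`.  It satisfies
`2℘'' = 12℘² - (4/3)π⁴E₄`, `(℘')² = 4℘³ - (4/3)π⁴E₄ ℘ - (8/27)π⁶E₆`, and
`∫_A ℘ dz = -(π²/3)E₂`. -/
noncomputable def wp (τ z : ℂ) : ℂ :=
  1 / z ^ 2 +
    ∑' p : ℤ × ℤ,
      if p = (0, 0) then 0
      else 1 / (z + ((p.1 : ℂ) + (p.2 : ℂ) * τ)) ^ 2 - 1 / ((p.1 : ℂ) + (p.2 : ℂ) * τ) ^ 2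

/-- `E₆(τ) = 1 - 504 ∑_{n ≥ 1} σ₅(n) qⁿ`. -/
noncomputable def E₆τ (τ : ℂ) : ℂ :=
  1 - 504 * ∑' n : ℕ,
    (ArithmeticFunction.sigma 5 (n + 1) : ℂ) * Complex.exp (2 * π * Complex.I * τ) ^ (n + 1)


open Filter Topology PeriodPair Set
open UpperHalfPlane hiding I

noncomputable def Lτ (τ : ℂ) (hτ : 0 < τ.im) : PeriodPair where
  ω₁ := τ
  ω₂ := 1
  indep := by
    rw [LinearIndependent.pair_iff]
    intro s t h
    have h1 := congrArg Complex.im h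
    have h2 := congrArg Complex.re h
    simp at h1 h2
    have : s = 0 := h1.resolve_right hτ.ne'
    subst this
    simpa using h2

lemma wp_eq (τ : ℂ) (hτ : 0 < τ.im) (z : ℂ) : wp τ z = ℘[Lτ τ hτ] z := by
  set L := Lτ τ hτ with hL
  have h0 := L.weierstrassPExcept_add 0 z
  simp only [ZeroMemClass.coe_zero, sub_zero] at h0
  rw [← h0, wp, add_comm]
  congr 1
  · rw [weierstrassPExcept]
    have e := ((Equiv.prodComm ℤ ℤ).trans (L.latticeEquivProd.symm.toEquiv)).trans (Equiv.neg _)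
    rw [← (((Equiv.prodComm ℤ ℤ).trans (L.latticeEquivProd.symm.toEquiv)).trans (Equiv.neg _)).tsum_eq]
    apply tsum_congr
    rintro ⟨a, b⟩
    have h1 : (L.latticeEquivProd.symm (b, a) : ℂ) = a + b * τ := by
      rw [L.latticeEquiv_symm_apply]; simp [hL, Lτ]; ring
    have h2 : (a : ℂ) + b * τ = 0 ↔ (a, b) = (0, 0) := by
      rw [← h1]
      simp [Prod.ext_iff, and_comm]
    simp only [Equiv.trans_apply, Equiv.prodComm_apply, Prod.swap, LinearEquiv.coe_toEquiv,
      Equiv.neg_apply, NegMemClass.coe_neg, h1, neg_eq_zero, h2, sub_neg_eq_add, neg_sq]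
  · simp

lemma path_notMem (τ : ℂ) (hτ : 0 < τ.im) (ε : ℝ) (hε0 : 0 < ε) (hε1 : ε < 1) (t : ℝ) :
    (ε : ℂ) * τ + t ∉ (Lτ τ hτ).lattice := by
  rw [mem_lattice]
  rintro ⟨m, n, h⟩
  have h1 := congrArg Complex.im h
  simp [Lτ] at h1
  rcases h1 with h1 | h1
  · rw [← h1] at hε0 hε1
    norm_cast at hε0 hε1
    omega
  · exact hτ.ne' h1

lemma conn (L : PeriodPair) : IsPreconnected ((L.lattice : Set ℂ)ᶜ) := by
  refine (Set.Countable.isConnected_compl_of_one_lt_rank (by simp) ?_).isPreconnected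
  have : Countable L.lattice := L.latticeEquivProd.toEquiv.countable_iff.mpr inferInstance
  exact Set.to_countable _

lemma deriv_ne (L : PeriodPair) : ¬ ∀ z ∈ (L.lattice : Set ℂ)ᶜ, ℘'[L] z = 0 := by
  intro h
  have hopen : IsOpen ((L.lattice : Set ℂ)ᶜ) := L.isClosed_lattice.isOpen_compl
  obtain ⟨c, hc⟩ := hopen.exists_is_const_of_deriv_eq_zero (conn L) L.differentiableOn_weierstrassP
    (fun z hz => by rw [deriv_weierstrassP]; exact h z hz)
  have h1 := L.order_weierstrassP 0 L.lattice.zero_mem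
  have h2 : ℘[L] =ᶠ[𝓝[≠] 0] fun _ => c := by
    have := L.compl_lattice_sdiff_singleton_mem_nhds 0
    rw [EventuallyEq, eventually_nhdsWithin_iff]
    filter_upwards [this] with z hz hz0
    apply hc
    intro h
    exact hz ⟨h, hz0⟩
  rw [meromorphicOrderAt_congr h2, meromorphicOrderAt_const] at h1
  split_ifs at h1 
  · exact absurd h1 (by decide)
  · exact absurd h1 (by decide)

lemma deriv2 (L : PeriodPair) (z : ℂ) (hz : z ∉ L.lattice) :
    HasDerivAt ℘'[L] (6 * ℘[L] z ^ 2 - L.g₂ / 2) z := by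
  have hopen : IsOpen ((L.lattice : Set ℂ)ᶜ) := L.isClosed_lattice.isOpen_compl
  have d0 : ∀ z ∉ L.lattice, HasDerivAt ℘[L] (℘'[L] z) z := fun z hz => by
    rw [← deriv_weierstrassP]
    exact (L.differentiableOn_weierstrassP.differentiableAt (hopen.mem_nhds hz)).hasDerivAt
  have d1 : ∀ z ∉ L.lattice, HasDerivAt ℘'[L] (deriv ℘'[L] z) z := fun z hz =>
    (L.differentiableOn_derivWeierstrassP.differentiableAt (hopen.mem_nhds hz)).hasDerivAt
  have key : ∀ z ∈ (L.lattice : Set ℂ)ᶜ,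
      ℘'[L] z * (2 * deriv ℘'[L] z - 12 * ℘[L] z ^ 2 + L.g₂) = 0 := by
    intro z hz
    have a := (d1 z hz).pow 2
    have b := ((((d0 z hz).pow 3).const_mul 4).sub ((d0 z hz).const_mul L.g₂)).sub_const L.g₃
    have c : (℘'[L] ^ 2) =ᶠ[𝓝 z] (fun z => 4 * (℘[L] ^ 3) z - L.g₂ * ℘[L] z - L.g₃) := by
      filter_upwards [hopen.mem_nhds hz] with w hw
      exact L.derivWeierstrassP_sq w hw
    have := (a.congr_of_eventuallyEq c.symm).unique b
    simp at this
    linear_combination this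
  have hA := L.analyticOnNhd_derivWeierstrassP
  have hP := L.analyticOnNhd_weierstrassP
  have := hA.eq_zero_or_eq_zero_of_mul_eq_zero (g := fun z => 2 * deriv ℘'[L] z - 12 * ℘[L] z ^ 2 + L.g₂)
    (fun w hw => by
      have := hA.deriv w hw
      have := hP w hw
      fun_prop) key (conn L)
  have := this.resolve_left (deriv_ne L) z hz
  have e : deriv ℘'[L] z = 6 * ℘[L] z ^ 2 - L.g₂ / 2 := by
    linear_combination this / 2
  rw [← e]
  exact d1 z hz

lemma cube_integral (τ : ℂ) (hτ : 0 < τ.im) (ε : ℝ) (hε0 : 0 < ε) (hε1 : ε < 1) :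
    ∫ t in (0:ℝ)..1, (℘[Lτ τ hτ] ((ε : ℂ) * τ + t)) ^ 3 =
     3 / 20 * (Lτ τ hτ).g₂ * (∫ t in (0:ℝ)..1, ℘[Lτ τ hτ] ((ε : ℂ) * τ + t)) + (Lτ τ hτ).g₃ / 10 := by
  set L := Lτ τ hτ with hL
  have hopen : IsOpen ((L.lattice : Set ℂ)ᶜ) := L.isClosed_lattice.isOpen_compl
  have hz := path_notMem τ hτ ε hε0 hε1
  rw [← hL] at hz
  have d0 : ∀ z ∉ L.lattice, HasDerivAt ℘[L] (℘'[L] z) z := fun z hz => by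
    rw [← deriv_weierstrassP]
    exact (L.differentiableOn_weierstrassP.differentiableAt (hopen.mem_nhds hz)).hasDerivAt
  have hc : Continuous (fun t : ℝ => ℘[L] ((ε : ℂ) * τ + t)) := by
    rw [continuous_iff_continuousAt]
    intro t
    exact ContinuousAt.comp (f := fun t : ℝ => ((ε : ℂ) * τ + t)) (d0 _ (hz t)).continuousAt (by fun_prop)
  have hd : ∀ t : ℝ, HasDerivAt (fun t : ℝ => ℘[L] ((ε : ℂ) * τ + t) * ℘'[L] ((ε : ℂ) * τ + t))
     (10 * ℘[L] ((ε : ℂ) * τ + t) ^ 3 - 3 / 2 * L.g₂ * ℘[L] ((ε : ℂ) * τ + t) - L.g₃) t := by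
    intro t
    have h1 := (d0 _ (hz t)).mul (deriv2 L _ (hz t))
    have h2 : HasDerivAt (fun w : ℂ => (ε : ℂ) * τ + w) 1 (t : ℂ) := by
      simpa using (hasDerivAt_id (t : ℂ)).const_add ((ε : ℂ) * τ)
    have h3 := (HasDerivAt.comp (t : ℂ) (h₂ := ℘[L] * ℘'[L]) (h := fun w : ℂ => (ε : ℂ) * τ + w) h1 h2).comp_ofReal
    have := L.derivWeierstrassP_sq _ (hz t)
    convert h3 using 1
    · rfl
    linear_combination - this
  have hi := intervalIntegral.integral_eq_sub_of_hasDerivAt (a := 0) (b := 1) (fun t _ => hd t)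
    (Continuous.intervalIntegrable (by fun_prop) _ _)
  have h1 : (1 : ℂ) ∈ L.lattice := L.ω₂_mem_lattice
  have p0 := L.weierstrassP_add_coe (ε * τ) ⟨1, h1⟩
  have p1 := L.derivWeierstrassP_add_coe (ε * τ) ⟨1, h1⟩
  simp only at p0 p1
  simp only [Complex.ofReal_one, Complex.ofReal_zero, add_zero, p0, p1, sub_self] at hi
  rw [intervalIntegral.integral_sub, intervalIntegral.integral_sub, intervalIntegral.integral_const_mul, intervalIntegral.integral_const_mul] at hi
  · simp at hi
    linear_combination hi / 10
  all_goals exact Continuous.intervalIntegrable (by fun_prop) _ _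

lemma G_eq (τ : ℂ) (hτ : 0 < τ.im) (k : ℕ) (hk : 3 ≤ k) (hk2 : Even k) :
    (Lτ τ hτ).G k = 2 * riemannZeta k + 2 * ((-2 * π * Complex.I) ^ k / (k - 1).factorial) *
    ∑' (n : ℕ), (ArithmeticFunction.sigma (k - 1) (n + 1) : ℂ) * Complex.exp (2 * π * Complex.I * τ) ^ (n + 1) := by
  have h := tsum_eisSummand_eq_tsum_sigma_mul_cexp_pow hk hk2 (⟨τ, hτ⟩ : ℍ)
  rw [tsum_pnat_eq_tsum_succ (f := fun n : ℕ => (ArithmeticFunction.sigma (k - 1) n : ℂ) * Complex.exp (2 * π * Complex.I * (⟨τ, hτ⟩ : ℍ)) ^ n)] at h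
  refine Eq.trans ?_ h
  rw [PeriodPair.G, ← ((finTwoArrowEquiv ℤ).trans (Lτ τ hτ).latticeEquivProd.symm.toEquiv).tsum_eq]
  apply tsum_congr
  intro v
  have e : (((finTwoArrowEquiv ℤ).trans (Lτ τ hτ).latticeEquivProd.symm.toEquiv) v : ℂ) =
      v 0 * τ + v 1 := by
    refine ((Lτ τ hτ).latticeEquiv_symm_apply (v 0, v 1)).trans ?_
    simp [Lτ]
  rw [e]
  simp [EisensteinSeries.eisSummand]

lemma zeta6 : riemannZeta 6 = (π : ℂ) ^ 6 / 945 := by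
  have h := riemannZeta_two_mul_nat (k := 3) (by norm_num)
  have b : bernoulli 6 = 1 / 42 := by
    rw [bernoulli_eq_bernoulli'_of_ne_one (by norm_num)]
    have c : Nat.choose 6 4 = 15 := by decide
    have c2 : Nat.choose 6 2 = 15 := by decide
    have h5 : bernoulli' 5 = 0 := by
      have : Nat.choose 5 2 = 10 := by decide
      have : Nat.choose 5 4 = 5 := by decide
      rw [bernoulli'_def]
      norm_num [Finset.sum_range_succ, *]
    rw [bernoulli'_def]
    norm_num [Finset.sum_range_succ, *]
  norm_num [b, Nat.factorial] at h
  rw [h]; ring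

lemma g2_eq (τ : ℂ) (hτ : 0 < τ.im) : (Lτ τ hτ).g₂ = 4 / 3 * π ^ 4 * E₄τ τ := by
  have hI : Complex.I ^ 4 = 1 := Complex.I_pow_four
  rw [PeriodPair.g₂, G_eq τ hτ 4 (by norm_num) (by decide), E₄τ]
  simp only [Nat.cast_ofNat, riemannZeta_four]
  norm_num [Nat.factorial, mul_pow, hI]
  ring

lemma g3_eq (τ : ℂ) (hτ : 0 < τ.im) : (Lτ τ hτ).g₃ = 8 / 27 * π ^ 6 * E₆τ τ := by
  have hI : Complex.I ^ 6 = -1 := by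
    rw [show Complex.I ^ 6 = Complex.I ^ 4 * Complex.I ^ 2 by ring]; simp
  rw [PeriodPair.g₃, G_eq τ hτ 6 (by norm_num) (by decide), E₆τ]
  simp only [Nat.cast_ofNat, zeta6]
  norm_num [Nat.factorial, mul_pow, hI]
  ring

lemma hasSum_int (τ : ℂ) (hτ : 0 < τ.im) (ε : ℝ) (hε0 : 0 < ε) (hε1 : ε < 1) :
    HasSum (fun l : (Lτ τ hτ).lattice => ∫ t in (0:ℝ)..1, (1 / ((ε : ℂ) * τ + t - l) ^ 2 - 1 / (l : ℂ) ^ 2))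
      (∫ t in (0:ℝ)..1, ℘[Lτ τ hτ] ((ε : ℂ) * τ + t)) := by
  have hz := path_notMem τ hτ ε hε0 hε1
  set L := Lτ τ hτ with hL
  have hne : ∀ (l : L.lattice) (t : ℝ), ((ε : ℂ) * τ + t - l) ≠ 0 := by
    intro l t h
    exact hz t (by rw [sub_eq_zero.mp h]; exact l.2)
  let f : L.lattice → C(ℝ, ℂ) := fun l =>
    ⟨fun t => 1 / ((ε : ℂ) * τ + t - l) ^ 2 - 1 / (l : ℂ) ^ 2, by
      have := hne l
      exact ((continuous_const).div (by fun_prop) (fun t => pow_ne_zero 2 (this t))).sub continuous_const⟩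
  have hs : Summable fun l => ‖(f l).restrict (⟨uIcc (0:ℝ) 1, isCompact_uIcc⟩ : TopologicalSpace.Compacts ℝ)‖ := by
    set r : ℝ := ‖(ε : ℂ) * τ‖ + 2
    have hr : 0 < r := by positivity
    have hu : Summable (fun l : L.lattice => 10 * r * ‖l‖ ^ (-3 : ℝ)) :=
      (ZLattice.summable_norm_rpow _ _ (by simp; norm_num)).mul_left _
    refine Summable.of_norm_bounded_eventually hu ?_
    refine (isCompact_iff_finite.mp (isCompact_closedBall (0 : L.lattice) (2 * r))).subset ?_
    intro l hl
    simp only [Metric.mem_closedBall, dist_zero_right]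
    contrapose! hl
    simp only [norm_norm, mem_compl_iff, not_not]
    change ‖_‖ ≤ _
    rw [ContinuousMap.norm_le _ (by positivity)]
    rintro ⟨t, ht⟩
    have ht : t ∈ uIcc (0:ℝ) 1 := ht
    rw [uIcc_of_le zero_le_one] at ht
    refine weierstrassP_bound r hr _ ?_ l hl.le
    refine (norm_add_le _ _).trans_lt ?_
    rw [Complex.norm_real, Real.norm_of_nonneg ht.1]
    linarith [ht.2]
  have := intervalIntegral.hasSum_intervalIntegral_of_summable_norm (a := 0) (b := 1) hs
  convert this using 1
  all_goals rfl

lemma int_term (l z : ℂ) (hz : ∀ t : ℝ, z + t - l ≠ 0) :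
    ∫ t in (0:ℝ)..1, (1 / (z + t - l) ^ 2 - 1 / l ^ 2) = 1 / (z - l) - 1 / (z + 1 - l) - (l ^ 2)⁻¹ := by
  have hd : ∀ t : ℝ, HasDerivAt (fun t : ℝ => - (z + t - l)⁻¹ - (1 / l ^ 2) * t)
     (1 / (z + t - l) ^ 2 - 1 / l ^ 2) t := by
    intro t
    have h2 : HasDerivAt (fun w : ℂ => z + w - l) 1 (t : ℂ) := by
      simpa using ((hasDerivAt_id (t : ℂ)).const_add z).sub_const l
    have h3 := ((h2.inv (hz t)).neg.sub ((hasDerivAt_id (t : ℂ)).const_mul (1 / l ^ 2))).comp_ofReal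
    convert h3 using 1
    · rfl
    · ring
  rw [intervalIntegral.integral_eq_sub_of_hasDerivAt (fun t _ => hd t)]
  · simp; ring
  · apply Continuous.intervalIntegrable
    exact ((continuous_const).div (by fun_prop) (fun t => pow_ne_zero 2 (hz t))).sub continuous_const

lemma hasSum_tel (w : ℂ) (h : Summable (fun n : ℤ => 1 / (w - n) - 1 / (w + 1 - n))) :
    HasSum (fun n : ℤ => 1 / (w - n) - 1 / (w + 1 - n)) 0 := by
  have h1 : HasSum _ _ (SummationFilter.symmetricIco ℤ) := h.hasSum.mono_left (SummationFilter.LeAtTop.le_atTop)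
  have h2 : HasSum (fun n : ℤ => 1 / (w - n) - 1 / (w + 1 - n)) 0 (SummationFilter.symmetricIco ℤ) := by
    rw [SummationFilter.hasSum_symmetricIco_int_iff]
    have e : ∀ N : ℕ, ∑ n ∈ Finset.Ico (-(N:ℤ)) N, (1 / (w - n) - 1 / (w + 1 - n)) =
       1 / (w - N + 1) - 1 / (w + N + 1) := by
      intro N
      have := Finset.sum_Ico_int_sub N (fun n : ℤ => - (1 / (w + 1 - n)))
      simp only [Int.cast_add, Int.cast_one, Int.cast_natCast, Int.cast_neg] at this
      rw [show 1 / (w - N + 1) - 1 / (w + N + 1) = -(1 / (w + 1 - - (N:ℂ))) - -(1 / (w + 1 - N)) by ring, ← this]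
      apply Finset.sum_congr rfl
      intro n _
      ring
    simp_rw [e]
    have t1 : Tendsto (fun N : ℕ => w - N + 1) atTop (Bornology.cobounded ℂ) := by
      rw [← tendsto_norm_atTop_iff_cobounded]
      refine tendsto_atTop_mono (f := fun N : ℕ => (N : ℝ) - ‖w + 1‖) (fun N => ?_)
        (tendsto_atTop_add_const_right _ _ tendsto_natCast_atTop_atTop)
      have := norm_sub_norm_le (N : ℂ) ((w + 1))
      rw [Complex.norm_natCast] at this
      refine this.trans (le_of_eq ?_)
      rw [norm_sub_rev]; congr 1; ring
    have t2 : Tendsto (fun N : ℕ => w + N + 1) atTop (Bornology.cobounded ℂ) := by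
      rw [← tendsto_norm_atTop_iff_cobounded]
      refine tendsto_atTop_mono (f := fun N : ℕ => (N : ℝ) - ‖w + 1‖) (fun N => ?_)
        (tendsto_atTop_add_const_right _ _ tendsto_natCast_atTop_atTop)
      have := norm_sub_norm_le (N : ℂ) (-(w + 1))
      rw [norm_neg, Complex.norm_natCast] at this
      refine this.trans (le_of_eq ?_)
      congr 1; ring
    simpa using (tendsto_inv₀_cobounded.comp t1).sub (tendsto_inv₀_cobounded.comp t2)
  rw [← h1.unique h2]
  exact h.hasSum

lemma int_wp (τ : ℂ) (hτ : 0 < τ.im) (ε : ℝ) (hε0 : 0 < ε) (hε1 : ε < 1) :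
    ∫ t in (0:ℝ)..1, ℘[Lτ τ hτ] ((ε : ℂ) * τ + t) = - (π ^ 2 / 3) * E₂τ τ := by
  have H := hasSum_int τ hτ ε hε0 hε1
  have hz := path_notMem τ hτ ε hε0 hε1
  set S := ∫ t in (0:ℝ)..1, ℘[Lτ τ hτ] ((ε : ℂ) * τ + t)
  have hint : ∀ l : (Lτ τ hτ).lattice, ∫ t in (0:ℝ)..1, (1 / ((ε : ℂ) * τ + t - l) ^ 2 - 1 / (l : ℂ) ^ 2)
     = 1 / (ε * τ - l) - 1 / (ε * τ + 1 - l) - ((l : ℂ) ^ 2)⁻¹ := by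
    intro l
    refine int_term l (ε * τ) (fun t h => ?_)
    exact hz t (by rw [sub_eq_zero.mp h]; exact l.2)
  simp_rw [hint] at H
  rw [← (Lτ τ hτ).latticeEquivProd.symm.toEquiv.hasSum_iff] at H
  have H' : HasSum (fun p : ℤ × ℤ => 1 / ((ε * τ - p.1 * τ) - p.2) - 1 / ((ε * τ - p.1 * τ) + 1 - p.2)
     - EisensteinSeries.eisSummand 2 ![p.1, p.2] (⟨τ, hτ⟩ : ℍ)) S := by
    convert H using 2 with p
    simp only [Function.comp_apply, LinearEquiv.coe_toEquiv, latticeEquiv_symm_apply]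
    simp [Lτ, EisensteinSeries.eisSummand, sub_sub, add_sub_assoc]
    ring
  have row : ∀ m : ℤ, HasSum (fun n : ℤ => 1 / ((ε * τ - m * τ) - n) - 1 / ((ε * τ - m * τ) + 1 - n)
     - EisensteinSeries.eisSummand 2 ![m, n] (⟨τ, hτ⟩ : ℍ)) (- EisensteinSeries.e2Summand m (⟨τ, hτ⟩ : ℍ)) := by
    intro m
    have s1 := H'.summable.prod_factor m
    have s2 := EisensteinSeries.e2Summand_summable m (⟨τ, hτ⟩ : ℍ)
    have s3 := hasSum_tel (ε * τ - m * τ) (by simpa using s1.add s2)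
    simpa [EisensteinSeries.e2Summand] using s3.sub s2.hasSum
  have h1 := (H'.prod_fiberwise row).neg
  simp only [neg_neg] at h1
  have h2 : HasSum _ _ (SummationFilter.symmetricIcc ℤ) := h1.mono_left (SummationFilter.LeAtTop.le_atTop)
  have h3 := h2.unique (EisensteinSeries.hasSum_e2Summand_symmetricIcc (⟨τ, hτ⟩ : ℍ))
  rw [tsum_pnat_eq_tsum_succ (f := fun n : ℕ => (ArithmeticFunction.sigma 1 n : ℂ) * Complex.exp (2 * π * Complex.I * (⟨τ, hτ⟩ : ℍ)) ^ n), riemannZeta_two] at h3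
  rw [E₂τ]
  simp only at h3
  linear_combination - h3

/-- The `A`-cycle integral of `℘³` over the segment from `ετ` to
`ετ + 1` (for `0 < ε < 1`) equals `-(π⁶/15) E₂(τ)E₄(τ) + (4π⁶/135) E₆(τ)`. -/
theorem A_cycle_integral_wp_cube (τ : ℂ) (hτ : 0 < τ.im) (ε : ℝ) (hε0 : 0 < ε) (hε1 : ε < 1) :
    ∫ t in (0:ℝ)..1, (wp τ ((ε : ℂ) * τ + t)) ^ 3 =
      -((π : ℂ) ^ 6 / 15) * E₂τ τ * E₄τ τ + 4 * (π : ℂ) ^ 6 / 135 * E₆τ τ := by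
  simp_rw [wp_eq τ hτ]
  rw [cube_integral τ hτ ε hε0 hε1, int_wp τ hτ ε hε0 hε1, g2_eq, g3_eq]
  ring
end

section
/- The q-series identity (2πi)⁶ ∑_{k≥1} k³(q^k + q^{2k})/(1-q^k)³ = ((2πi)⁶/12³)(-E₂³ + 3E₂E₄ - 2E₆) holds for τ in the upper half-plane with q = e^{2πiτ}, where E₂, E₄, E₆ are the normalized Eisenstein series; equivalently ∑_{k≥1} k³(q^k+q^{2k})/(1-q^k)³ = -(1/24)(q d/dq)² E₂. -/
open Complex Real

/-- `E₂ = 1 - 24 ∑_{n ≥ 1} σ₁(n) qⁿ`. -/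
noncomputable def E₂ (q : ℂ) : ℂ :=
  1 - 24 * ∑' n : ℕ, (ArithmeticFunction.sigma 1 (n + 1) : ℂ) * q ^ (n + 1)

/-- `E₄ = 1 + 240 ∑_{n ≥ 1} σ₃(n) qⁿ`. -/
noncomputable def E₄ (q : ℂ) : ℂ :=
  1 + 240 * ∑' n : ℕ, (ArithmeticFunction.sigma 3 (n + 1) : ℂ) * q ^ (n + 1)

/-- `E₆ = 1 - 504 ∑_{n ≥ 1} σ₅(n) qⁿ`. -/
noncomputable def E₆ (q : ℂ) : ℂ :=
  1 - 504 * ∑' n : ℕ, (ArithmeticFunction.sigma 5 (n + 1) : ℂ) * q ^ (n + 1)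


noncomputable def Pser (a : ℕ → ℂ) (q : ℂ) : ℂ := ∑' n : ℕ, a n * q ^ n

lemma summable_poly (a : ℕ → ℂ) (l : ℕ) (ha : ∀ n, ‖a n‖ ≤ (n : ℝ) ^ l) {q : ℂ} (hq : ‖q‖ < 1) :
    Summable fun n => a n * q ^ n := by
  refine Summable.of_norm_bounded
    (summable_norm_pow_mul_geometric_of_norm_lt_one (R := ℂ) l hq) fun n => ?_
  simp only [norm_mul, norm_pow, Complex.norm_natCast]
  gcongr
  exact ha n

lemma Pser_deriv (a : ℕ → ℂ) (l : ℕ) (ha : ∀ n, ‖a n‖ ≤ (n : ℝ) ^ l) {q : ℂ} (hq : ‖q‖ < 1) :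
    HasDerivAt (Pser a) (∑' n : ℕ, a n * (n * q ^ (n - 1))) q := by
  obtain ⟨r, hr1, hr2⟩ := exists_between hq
  have hr0 : 0 < r := lt_of_le_of_lt (norm_nonneg q) hr1
  have hs : Summable fun n : ℕ => (n : ℝ) ^ (l + 1) * r ^ n :=
    summable_pow_mul_geometric_of_norm_lt_one (R := ℝ) (l + 1)
      (by rwa [Real.norm_of_nonneg hr0.le])
  refine hasDerivAt_tsum_of_isPreconnected (t := Metric.ball (0 : ℂ) r) (y₀ := q)
    (u := fun n : ℕ => ((n : ℝ) ^ (l + 1) * r ^ n) * r⁻¹) (g := fun n z => a n * z ^ n)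
    (g' := fun n z => a n * (n * z ^ (n - 1)))
    (hs.mul_right _) Metric.isOpen_ball (convex_ball _ _).isPreconnected
    (fun n y _ => (hasDerivAt_pow n y).const_mul _) ?_ (by simpa using hr1)
    (summable_poly a l ha hq) (by simpa using hr1)
  intro n y hy
  have hy : ‖y‖ < r := by simpa using hy
  rcases n with _ | n
  · simp
  · simp only [norm_mul, norm_pow, Complex.norm_natCast, Nat.add_sub_cancel]
    have : ((n + 1 : ℕ) : ℝ) ^ (l + 1) * r ^ (n + 1) * r⁻¹
        = ((n + 1 : ℕ) : ℝ) ^ l * (((n + 1 : ℕ) : ℝ) * r ^ n) := by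
      field_simp
      ring
    rw [this]
    gcongr
    exact ha _

lemma norm_q_lt {τ : ℂ} (hτ : 0 < τ.im) : ‖cexp (2 * π * I * τ)‖ < 1 :=
  UpperHalfPlane.norm_exp_two_pi_I_lt_one ⟨τ, hτ⟩

lemma Pser_comp_deriv (a : ℕ → ℂ) (l : ℕ) (ha : ∀ n, ‖a n‖ ≤ (n : ℝ) ^ l) {τ : ℂ}
    (hτ : 0 < τ.im) :
    HasDerivAt (fun t => Pser a (cexp (2 * π * I * t)))
      (2 * π * I * Pser (fun n => n * a n) (cexp (2 * π * I * τ))) τ := by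
  have h1 := Pser_deriv a l ha (norm_q_lt hτ)
  have h2 : HasDerivAt (fun t : ℂ => cexp (2 * π * I * t))
      (cexp (2 * π * I * τ) * (2 * π * I)) τ := by
    simpa using ((hasDerivAt_id τ).const_mul (2 * π * I)).cexp
  have h3 := h1.comp τ h2
  refine h3.congr_deriv ?_
  rw [Pser, ← mul_assoc, mul_comm, ← tsum_mul_right]
  congr 1
  refine tsum_congr fun n => ?_
  rcases n with _ | n
  · simp
  · simp [pow_succ]; ring

lemma bound_succ (a : ℕ → ℂ) (l : ℕ) (ha : ∀ n, ‖a n‖ ≤ (n : ℝ) ^ l) (n : ℕ) :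
    ‖(n : ℂ) * a n‖ ≤ (n : ℝ) ^ (l + 1) := by
  rw [norm_mul, Complex.norm_natCast, pow_succ']
  gcongr
  exact ha n

lemma bound_sigma (k n : ℕ) : ‖(ArithmeticFunction.sigma k n : ℂ)‖ ≤ (n : ℝ) ^ (k + 1) := by
  rw [Complex.norm_natCast]
  exact_mod_cast ArithmeticFunction.sigma_le_pow_succ k n

open UpperHalfPlane (atImInfty qParam_tendsto_atImInfty) in
open Filter Topology in
lemma Pser_tendsto (a : ℕ → ℂ) (l : ℕ) (ha : ∀ n, ‖a n‖ ≤ (n : ℝ) ^ l) :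
    Tendsto (fun z : UpperHalfPlane => Pser a (cexp (2 * π * I * z))) atImInfty (𝓝 (a 0)) := by
  have h1 := (Pser_deriv a l ha (q := 0) (by simp)).continuousAt.tendsto
  have h2 := h1.comp (qParam_tendsto_atImInfty one_pos)
  have h0 : Pser a 0 = a 0 := by
    rw [Pser, tsum_eq_single 0]
    · simp
    · intro n hn; simp [hn]
  rw [h0] at h2
  refine h2.congr fun z => ?_
  simp [Function.Periodic.qParam]

lemma Pser_sigma (k : ℕ) (q : ℂ) (hq : ‖q‖ < 1) :
    ∑' n : ℕ, (ArithmeticFunction.sigma k (n + 1) : ℂ) * q ^ (n + 1) =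
      Pser (fun n => (ArithmeticFunction.sigma k n : ℂ)) q := by
  rw [Pser, (summable_poly _ _ (bound_sigma k) hq).tsum_eq_zero_add]
  simp

lemma geom_sq {x : ℂ} (hx : ‖x‖ < 1) :
    HasSum (fun m : ℕ => (m : ℂ) ^ 2 * x ^ m) ((x + x ^ 2) / (1 - x) ^ 3) := by
  have h (k : ℕ) : HasSum (fun n : ℕ => ((n + k).choose k : ℂ) * x ^ n) (1 / (1 - x) ^ (k + 1)) := by
    rw [← tsum_choose_mul_geometric_of_norm_lt_one k hx]
    exact (summable_choose_mul_geometric_of_norm_lt_one k hx).hasSum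
  have h1 := (((h 2).mul_left 2).sub ((h 1).mul_left 3)).add (h 0)
  have hx1 : 1 - x ≠ 0 := by
    intro h; rw [sub_eq_zero] at h; rw [← h] at hx; simp at hx
  convert! h1 using 1
  · ext n
    rw [Nat.cast_choose_two]
    simp
    ring
  · field_simp
    ring

lemma lhs_eq {q : ℂ} (hq : ‖q‖ < 1) :
    ∑' k : ℕ, ((k + 1 : ℕ) : ℂ) ^ 3 * (q ^ (k + 1) + q ^ (2 * (k + 1))) / (1 - q ^ (k + 1)) ^ 3 =
    Pser (fun n => n * (n * (ArithmeticFunction.sigma 1 n : ℂ))) q := by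
  have hb : ∀ n : ℕ, ‖((n : ℂ) * (n * (ArithmeticFunction.sigma 1 n : ℂ)))‖ ≤ (n : ℝ) ^ 4 :=
    bound_succ _ 3 (bound_succ _ 2 (bound_sigma 1))
  have hS : Summable fun c : (ℕ+ × ℕ+) =>
      ((c.1 : ℂ)) ^ 3 * ((c.2 : ℂ) ^ 2 * (q ^ (c.1 : ℕ)) ^ (c.2 : ℕ)) := by
    have hs1 : √‖q‖ < 1 := by rw [Real.sqrt_lt' one_pos]; simpa using hq
    have hg (l : ℕ) : Summable fun n : ℕ+ => (n : ℝ) ^ l * √‖q‖ ^ (n : ℕ) :=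
      (summable_pow_mul_geometric_of_norm_lt_one (R := ℝ) l (r := √‖q‖)
        (by rwa [Real.norm_of_nonneg (Real.sqrt_nonneg _)])).comp_injective PNat.coe_injective
    refine Summable.of_norm_bounded ((hg 3).mul_of_nonneg (hg 2)
      (fun n => by positivity) (fun n => by positivity)) fun c => ?_
    have h3 : ‖q‖ ^ ((c.1 : ℕ) * (c.2 : ℕ)) ≤ √‖q‖ ^ (c.1 : ℕ) * √‖q‖ ^ (c.2 : ℕ) := by
      conv_lhs => rw [← Real.sq_sqrt (norm_nonneg q)]
      rw [← pow_mul, ← pow_add]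
      refine pow_le_pow_of_le_one (Real.sqrt_nonneg _) hs1.le ?_
      have h1 := c.1.pos
      have h2 := c.2.pos
      nlinarith
    simp only [norm_mul, norm_pow, Complex.norm_natCast]
    rw [← pow_mul]
    calc _ ≤ (c.1 : ℝ) ^ 3 * ((c.2 : ℝ) ^ 2 * (√‖q‖ ^ (c.1 : ℕ) * √‖q‖ ^ (c.2 : ℕ))) := by
          gcongr
      _ = _ := by ring
  have h1 : ∑' k : ℕ, ((k + 1 : ℕ) : ℂ) ^ 3 * (q ^ (k + 1) + q ^ (2 * (k + 1))) /
        (1 - q ^ (k + 1)) ^ 3 =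
      ∑' k : ℕ+, ∑' m : ℕ+, (k : ℂ) ^ 3 * ((m : ℂ) ^ 2 * (q ^ (k : ℕ)) ^ (m : ℕ)) := by
    rw [← tsum_pnat_eq_tsum_succ (f := fun k : ℕ => (k : ℂ) ^ 3 * (q ^ k + q ^ (2 * k)) /
        (1 - q ^ k) ^ 3)]
    refine tsum_congr fun k => ?_
    have hx : ‖q ^ (k : ℕ)‖ < 1 := by
      rw [norm_pow]; exact pow_lt_one₀ (norm_nonneg _) hq k.ne_zero
    have h := geom_sq hx
    rw [tsum_mul_left, tsum_pnat_eq_tsum_succ (f := fun m : ℕ => (m : ℂ) ^ 2 * (q ^ (k : ℕ)) ^ m)]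
    have h' := h.summable.tsum_eq_zero_add
    rw [h.tsum_eq] at h'
    simp only [Nat.cast_zero, ne_eq, OfNat.ofNat_ne_zero, not_false_eq_true, zero_pow, zero_mul,
      zero_add] at h'
    rw [← h', mul_div_assoc, ← pow_mul q, mul_comm (k : ℕ) 2]
  have hS' := (sigmaAntidiagonalEquivProd.summable_iff).mpr hS
  rw [h1, ← hS.tsum_prod, ← sigmaAntidiagonalEquivProd.tsum_eq]
  have h2 := hS'.tsum_sigma
  simp only [Function.comp_apply] at h2
  rw [h2]
  rw [Pser, (summable_poly _ _ hb hq).tsum_eq_zero_add]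
  rw [← tsum_pnat_eq_tsum_succ (f := fun n : ℕ => ((n : ℂ) * (n * (ArithmeticFunction.sigma 1 n : ℂ))) * q ^ n)]
  simp only [Nat.cast_zero, zero_mul, zero_add]
  refine tsum_congr fun n => ?_
  rw [tsum_fintype]
  have h3 : ∀ x : (n : ℕ).divisorsAntidiagonal,
      ((sigmaAntidiagonalEquivProd ⟨n, x⟩).1 : ℂ) ^ 3 *
        (((sigmaAntidiagonalEquivProd ⟨n, x⟩).2 : ℂ) ^ 2 *
          (q ^ ((sigmaAntidiagonalEquivProd ⟨n, x⟩).1 : ℕ)) ^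
            ((sigmaAntidiagonalEquivProd ⟨n, x⟩).2 : ℕ)) =
      (n : ℂ) ^ 2 * q ^ (n : ℕ) * (x.1.1 : ℂ) := by
    rintro ⟨⟨a, b⟩, hx⟩
    have hab : a * b = n := (Nat.mem_divisorsAntidiagonal.mp hx).1
    have hab' : (a : ℂ) * b = (n : ℕ) := by exact_mod_cast hab
    simp only [sigmaAntidiagonalEquivProd, divisorsAntidiagonalFactors, Equiv.coe_fn_mk,
      PNat.mk_coe]
    rw [← pow_mul, hab, ← hab']
    ring
  rw [Finset.sum_congr rfl (fun x _ => h3 x), ← Finset.mul_sum, Finset.univ_eq_attach,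
    (n : ℕ).divisorsAntidiagonal.sum_attach (fun x : ℕ × ℕ => (x.1 : ℂ)),
    Nat.sum_divisorsAntidiagonal (fun x _ => (x : ℂ)), ArithmeticFunction.sigma_one_apply]
  push_cast
  ring

namespace Ram
open UpperHalfPlane hiding I
open Filter Topology Manifold MatrixGroups ModularForm Derivative

lemma eq_zero_of_small {k : ℤ} (hk : k < 12) (f : ℍ → ℂ) (hf : MDiff f)
    (hs : ∀ γ : SL(2, ℤ), f ∣[k] γ = f) (h0 : Tendsto f atImInfty (𝓝 0)) : f = 0 := by
  let g : CuspForm 𝒮ℒ k :=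
    { toFun := f
      slash_action_eq' := fun _ ⟨γ, hγ⟩ ↦ hγ ▸ hs γ
      holo' := hf
      zero_at_cusps' := by
        intro c hc
        rw [Subgroup.IsArithmetic.isCusp_iff_isCusp_SL2Z] at hc
        rw [OnePoint.isZeroAt_iff_forall_SL2Z hc]
        intro γ _
        rw [hs γ]
        exact h0 }
  have := rank_zero_iff_forall_zero.mp (CuspForm.rank_eq_zero_of_weight_lt_twelve hk) g
  exact congrArg DFunLike.coe this

noncomputable abbrev Q (z : ℍ) : ℂ := cexp (2 * π * I * z)
abbrev sg (k : ℕ) : ℕ → ℂ := fun n => (ArithmeticFunction.sigma k n : ℂ)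

lemma Q_lt (z : ℍ) : ‖Q z‖ < 1 := norm_q_lt z.2

lemma E2_eq (z : ℍ) : EisensteinSeries.E2 z = 1 - 24 * Pser (sg 1) (Q z) := by
  rw [EisensteinSeries.E2_eq_tsum_cexp, ← Pser_sigma 1 _ (Q_lt z),
    tsum_pnat_eq_tsum_succ (f := fun n : ℕ => (ArithmeticFunction.sigma 1 n : ℂ) * cexp (2 * π * I * z) ^ n)]

lemma E4_eq (z : ℍ) : ModularForm.E₄ z = 1 + 240 * Pser (sg 3) (Q z) := by
  have h := EisensteinSeries.q_expansion_bernoulli (k := 4) (by norm_num) ⟨2, rfl⟩ z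
  rw [← Pser_sigma 3 _ (Q_lt z)]
  refine h.trans ?_
  simp only [zpow_natCast]
  rw [tsum_pnat_eq_tsum_succ (f := fun n : ℕ => (ArithmeticFunction.sigma 3 n : ℂ) * cexp (2 * π * I * z) ^ n),
    show bernoulli 4 = -1 / 30 by decide +kernel]
  norm_num

lemma E6_eq (z : ℍ) : ModularForm.E₆ z = 1 - 504 * Pser (sg 5) (Q z) := by
  have h := EisensteinSeries.q_expansion_bernoulli (k := 6) (by norm_num) ⟨3, rfl⟩ z
  rw [← Pser_sigma 5 _ (Q_lt z)]
  refine h.trans ?_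
  simp only [zpow_natCast]
  rw [tsum_pnat_eq_tsum_succ (f := fun n : ℕ => (ArithmeticFunction.sigma 5 n : ℂ) * cexp (2 * π * I * z) ^ n),
    show bernoulli 6 = 1 / 42 by decide +kernel]
  norm_num

lemma D_Pser (a : ℕ → ℂ) (l : ℕ) (ha : ∀ n, ‖a n‖ ≤ (n : ℝ) ^ l) (c d : ℂ) (F : ℍ → ℂ)
    (hF : ∀ z, F z = c + d * Pser a (Q z)) (z : ℍ) :
    D F z = d * Pser (fun n => n * a n) (Q z) := by
  have h := ((Pser_comp_deriv a l ha z.2).const_mul d).const_add c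
  have h2 : F ∘ ofComplex =ᶠ[𝓝 (z : ℂ)] fun t => c + d * Pser a (cexp (2 * π * I * t)) := by
    filter_upwards [isOpen_upperHalfPlaneSet.mem_nhds z.im_pos] with w hw
    rw [Function.comp_apply, hF, ofComplex_apply_of_im_pos hw]
  rw [normalizedDerivOfComplex, h2.deriv_eq, HasDerivAt.deriv h]
  have : (2 * π * I : ℂ) ≠ 0 := by simp [Real.pi_ne_zero]
  field_simp

lemma DE2 (z : ℍ) : D EisensteinSeries.E2 z = -24 * Pser (fun n => n * sg 1 n) (Q z) :=
  D_Pser (sg 1) 2 (bound_sigma 1) 1 (-24) _ (fun z => by rw [E2_eq]; ring) z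

lemma DDE2 (z : ℍ) : D (D EisensteinSeries.E2) z = -24 * Pser (fun n => n * (n * sg 1 n)) (Q z) :=
  D_Pser (fun n => n * sg 1 n) 3 (bound_succ _ _ (bound_sigma 1)) 0 (-24) _
    (fun z => by rw [DE2]; ring) z

lemma DE4 (z : ℍ) : D ModularForm.E₄ z = 240 * Pser (fun n => n * sg 3 n) (Q z) :=
  D_Pser (sg 3) 4 (bound_sigma 3) 1 240 _ (fun z => by rw [E4_eq]) z

lemma E2_lim : Tendsto EisensteinSeries.E2 atImInfty (𝓝 1) := by
  have h := ((Pser_tendsto (sg 1) 2 (bound_sigma 1)).const_mul 24).const_sub 1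
  simp only [sg, ArithmeticFunction.map_zero, Nat.cast_zero, mul_zero, sub_zero] at h
  exact h.congr fun z => (E2_eq z).symm

lemma E4_lim : Tendsto ModularForm.E₄ atImInfty (𝓝 1) := by
  have h := ((Pser_tendsto (sg 3) 4 (bound_sigma 3)).const_mul 240).const_add 1
  simp only [sg, ArithmeticFunction.map_zero, Nat.cast_zero, mul_zero, add_zero] at h
  exact h.congr fun z => (E4_eq z).symm

lemma E6_lim : Tendsto ModularForm.E₆ atImInfty (𝓝 1) := by
  have h := ((Pser_tendsto (sg 5) 6 (bound_sigma 5)).const_mul 504).const_sub 1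
  simp only [sg, ArithmeticFunction.map_zero, Nat.cast_zero, mul_zero, sub_zero] at h
  exact h.congr fun z => (E6_eq z).symm

lemma DE2_lim : Tendsto (D EisensteinSeries.E2) atImInfty (𝓝 0) := by
  have h := ((Pser_tendsto _ 3 (bound_succ _ _ (bound_sigma 1))).const_mul (-24))
  simp only [Nat.cast_zero, mul_zero, zero_mul] at h
  exact h.congr fun z => (DE2 z).symm

lemma DE4_lim : Tendsto (D ModularForm.E₄) atImInfty (𝓝 0) := by
  have h := ((Pser_tendsto _ 5 (bound_succ _ _ (bound_sigma 3))).const_mul 240)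
  simp only [Nat.cast_zero, mul_zero, zero_mul] at h
  exact h.congr fun z => (DE4 z).symm

lemma slash_E4 (γ : SL(2, ℤ)) : (ModularForm.E₄ : ℍ → ℂ) ∣[(4 : ℤ)] γ = ModularForm.E₄ :=
  SlashInvariantForm.slash_action_eqn ModularForm.E₄ _ ⟨γ, rfl⟩

lemma slash_E6 (γ : SL(2, ℤ)) : (ModularForm.E₆ : ℍ → ℂ) ∣[(6 : ℤ)] γ = ModularForm.E₆ :=
  SlashInvariantForm.slash_action_eqn ModularForm.E₆ _ ⟨γ, rfl⟩

lemma MD_E4 : MDiff (ModularForm.E₄ : ℍ → ℂ) := ModularForm.E₄.holo'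
lemma MD_E6 : MDiff (ModularForm.E₆ : ℍ → ℂ) := ModularForm.E₆.holo'
lemma MD_E2 : MDiff (EisensteinSeries.E2 : ℍ → ℂ) := E2_mdifferentiable

lemma ram4 (z : ℍ) : D ModularForm.E₄ z =
    (EisensteinSeries.E2 z * ModularForm.E₄ z - ModularForm.E₆ z) / 3 := by
  have h := eq_zero_of_small (k := 6) (by norm_num)
    (serreDerivative (4 : ℤ) ModularForm.E₄ + (1 / 3 : ℂ) • (ModularForm.E₆ : ℍ → ℂ))
    ((serreDerivative_mdifferentiable _ MD_E4).add (MD_E6.const_smul _)) (fun γ => by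
      rw [SlashAction.add_slash, ModularForm.SL_smul_slash, slash_E6]
      congr 1
      exact serreDerivative_slash_invariant (k := 4) MD_E4 (slash_E4 γ)) (by
      have := (DE4_lim.sub ((E2_lim.const_mul ((4 : ℤ) * 12⁻¹ : ℂ)).mul E4_lim)).add (E6_lim.const_mul (1 / 3 : ℂ))
      norm_num at this
      refine this.congr fun z => ?_
      simp only [Pi.add_apply, serreDerivative_apply, Pi.smul_apply, smul_eq_mul]
      push_cast
      ring)
  have h := congrFun h z
  simp at h
  linear_combination h

lemma slash_f (γ : SL(2, ℤ)) :
    (D EisensteinSeries.E2 - (1 / 12 : ℂ) • (EisensteinSeries.E2 * EisensteinSeries.E2)) ∣[(4 : ℤ)] γ =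
    D EisensteinSeries.E2 - (1 / 12 : ℂ) • (EisensteinSeries.E2 * EisensteinSeries.E2) := by
  have hE := EisensteinSeries.E2_slash_action γ
  have h1 := normalizedDerivOfComplex_SL_slash (k := 2) MD_E2 (γ := γ)
  ext z
  have hD2 : HasDerivAt ((EisensteinSeries.E2 ∣[(2 : ℤ)] γ) ∘ ofComplex)
      (2 * π * I * D EisensteinSeries.E2 z
        + (1 / (2 * riemannZeta 2)) * (2 * π * I * (γ 1 0 : ℂ) ^ 2) / (denom γ z) ^ 2) z := by
    have hd0 : ((γ 1 0 : ℂ) * z + (γ 1 1 : ℂ)) ≠ 0 := by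
      have := denom_ne_zero γ z
      rwa [ModularGroup.denom_apply] at this
    have e1 : HasDerivAt (EisensteinSeries.E2 ∘ ofComplex) (2 * π * I * D EisensteinSeries.E2 z) z := by
      have h := (UpperHalfPlane.mdifferentiableAt_iff.mp (MD_E2 z)).hasDerivAt
      have : (2 * π * I : ℂ) ≠ 0 := by simp [Real.pi_ne_zero]
      have h' : 2 * π * I * D EisensteinSeries.E2 z = deriv (EisensteinSeries.E2 ∘ ofComplex) z := by
        change 2 * π * I * ((2 * π * I)⁻¹ * _) = _
        rw [mul_inv_cancel_left₀ this]
      rw [h']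
      exact h
    have e2 : HasDerivAt (fun t : ℂ => (γ 1 0 : ℂ) * t + (γ 1 1 : ℂ)) (γ 1 0 : ℂ) z := by
      simpa using ((hasDerivAt_id (z : ℂ)).const_mul (γ 1 0 : ℂ)).add_const (γ 1 1 : ℂ)
    have e3 := e1.sub ((e2.inv hd0).const_mul ((1 / (2 * riemannZeta 2)) * (2 * π * I * (γ 1 0 : ℂ))))
    have e4 : (EisensteinSeries.E2 ∣[(2 : ℤ)] γ) ∘ ofComplex =ᶠ[𝓝 (z : ℂ)]
        (EisensteinSeries.E2 ∘ ofComplex) - fun t : ℂ => ((1 / (2 * riemannZeta 2)) * (2 * π * I * (γ 1 0 : ℂ))) *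
          ((γ 1 0 : ℂ) * t + (γ 1 1 : ℂ))⁻¹ := by
      filter_upwards [isOpen_upperHalfPlaneSet.mem_nhds z.im_pos] with w hw
      rw [Function.comp_apply, hE]
      simp only [Pi.sub_apply, Function.comp_apply, Pi.smul_apply, smul_eq_mul, EisensteinSeries.D2,
        ofComplex_apply_of_im_pos hw]
      have hw' := ModularGroup.denom_apply γ ⟨w, hw⟩
      simp only at hw'
      rw [hw']
      ring
    refine HasDerivAt.congr_of_eventuallyEq ?_ e4
    have e5 : 2 * π * I * D EisensteinSeries.E2 z
        + (1 / (2 * riemannZeta 2)) * (2 * π * I * (γ 1 0 : ℂ) ^ 2) / (denom γ z) ^ 2 =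
      2 * π * I * D EisensteinSeries.E2 z - 1 / (2 * riemannZeta 2) * (2 * π * I * (γ 1 0 : ℂ)) *
        (-(γ 1 0 : ℂ) / ((γ 1 0 : ℂ) * z + (γ 1 1 : ℂ)) ^ 2) := by
      rw [ModularGroup.denom_apply]
      ring
    rw [e5]
    exact e3
  have h1z := congrFun h1 z
  have hEz := congrFun hE z
  rw [normalizedDerivOfComplex, hD2.deriv] at h1z
  rw [sub_eq_add_neg, SlashAction.add_slash, SlashAction.neg_slash, ModularForm.SL_smul_slash]
  have hm := ModularForm.mul_slash_SL2 2 2 γ EisensteinSeries.E2 EisensteinSeries.E2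
  norm_num at hm
  rw [hm]
  have hpi : (π : ℂ) ≠ 0 := by simp [Real.pi_ne_zero]
  have hd := denom_ne_zero γ z
  rw [show (2 : ℤ) + 2 = 4 by norm_num] at h1z
  simp only [Pi.sub_apply, Pi.add_apply, Pi.neg_apply, Pi.mul_apply, Pi.smul_apply, smul_eq_mul,
    EisensteinSeries.D2, riemannZeta_two] at h1z hEz ⊢
  rw [hEz] at h1z ⊢
  have hh := eq_add_of_sub_eq h1z.symm
  rw [hh]
  generalize denom (γ : GL (Fin 2) ℝ) (z : ℂ) = d at hd
  generalize (γ 1 0 : ℂ) = c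
  generalize D EisensteinSeries.E2 z = u
  generalize EisensteinSeries.E2 z = v
  clear hh h1z hEz hm hD2 h1 hE
  have hI : I ^ 2 = -1 := I_sq
  have hI0 : I ≠ 0 := I_ne_zero
  push_cast
  field_simp
  ring_nf
  simp only [show I ^ 3 = -I by rw [pow_succ, I_sq]; ring, I_sq]
  ring

lemma ram2 : D EisensteinSeries.E2 =
    (1 / 12 : ℂ) • (EisensteinSeries.E2 * EisensteinSeries.E2 - ModularForm.E₄) := by
  have h := eq_zero_of_small (k := 4) (by norm_num)
    ((D EisensteinSeries.E2 - (1 / 12 : ℂ) • (EisensteinSeries.E2 * EisensteinSeries.E2))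
      + (1 / 12 : ℂ) • (ModularForm.E₄ : ℍ → ℂ))
    (((normalizedDerivOfComplex_mdifferentiable MD_E2).sub
      ((MD_E2.mul MD_E2).const_smul _)).add (MD_E4.const_smul _)) (fun γ => by
      rw [SlashAction.add_slash, ModularForm.SL_smul_slash, slash_E4, slash_f]) (by
      have := (DE2_lim.sub ((E2_lim.mul E2_lim).const_mul (1 / 12 : ℂ))).add (E4_lim.const_mul (1 / 12 : ℂ))
      norm_num at this
      refine this.congr fun z => ?_
      simp)
  ext z
  have h := congrFun h z
  simp at h ⊢
  linear_combination h

lemma final (z : ℍ) : 1728 * Pser (fun n => n * (n * sg 1 n)) (Q z) =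
    -EisensteinSeries.E2 z ^ 3 + 3 * EisensteinSeries.E2 z * ModularForm.E₄ z
      - 2 * ModularForm.E₆ z := by
  have h := DDE2 z
  have h4 := ram4 z
  have h2 := congrFun ram2 z
  rw [ram2, normalizedDerivOfComplex_smul _ _ ((MD_E2.mul MD_E2).sub MD_E4),
    normalizedDerivOfComplex_sub _ _ (MD_E2.mul MD_E2) MD_E4,
    normalizedDerivOfComplex_mul _ _ MD_E2 MD_E2] at h
  simp only [Pi.smul_apply, Pi.sub_apply, Pi.add_apply, Pi.mul_apply, smul_eq_mul] at h h2
  rw [h4, h2] at h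
  linear_combination 72 * h

end Ram
/-- The `q`-series identity
`(2πi)⁶ ∑_{k ≥ 1} k³(qᵏ + q^{2k})/(1 - qᵏ)³ = ((2πi)⁶/12³)(-E₂³ + 3E₂E₄ - 2E₆)`
holds for `τ` in the upper half-plane with `q = e^{2πiτ}`. -/
theorem qseries_identity_triangle (τ : ℂ) (hτ : 0 < τ.im) :
    (2 * π * Complex.I) ^ 6 *
        ∑' k : ℕ, ((k + 1 : ℕ) : ℂ) ^ 3 *
          (Complex.exp (2 * π * Complex.I * τ) ^ (k + 1) +
            Complex.exp (2 * π * Complex.I * τ) ^ (2 * (k + 1))) /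
          (1 - Complex.exp (2 * π * Complex.I * τ) ^ (k + 1)) ^ 3 =
      (2 * π * Complex.I) ^ 6 / 12 ^ 3 *
        (-E₂ (Complex.exp (2 * π * Complex.I * τ)) ^ 3 +
          3 * E₂ (Complex.exp (2 * π * Complex.I * τ)) *
            E₄ (Complex.exp (2 * π * Complex.I * τ)) -
          2 * E₆ (Complex.exp (2 * π * Complex.I * τ))) := by
  have hq := norm_q_lt hτ
  have h := Ram.final ⟨τ, hτ⟩
  rw [Ram.E2_eq, Ram.E4_eq, Ram.E6_eq] at h
  rw [lhs_eq hq, E₂, E₄, E₆, Pser_sigma 1 _ hq, Pser_sigma 3 _ hq, Pser_sigma 5 _ hq]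
  simp only [Ram.Q, Ram.sg] at h
  rw [← h]
  ring
end
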